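/- Let f : ℝ^d → ℝ be differentiable with ‖∇f‖_∞ < ∞. Then for every dyadic cube I ∈ 𝒟 and every x ∈ ℝ^d, | (1/|I|) Σ_{I',I''⊂I, ℓ(I')=2^{−m}ℓ(I), ℓ(I'')=2^{−n}ℓ(I)} ⟨f, h_{I'}⟩ h_{I''}(x) | ≤ 2^{−m} √d ‖∇f‖_∞ ℓ(I). -/

import Mathlib

open MeasureTheory Set Filter
open scoped ENNReal NNReal

noncomputable section

/-- The standard dyadic cube `2^k([0,1)^d + N)` in `ℝ^d`. -/
def cube (d : ℕ) (k : ℤ) (N : Fin d → ℤ) : Set (Fin d → ℝ) :=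
  {x | ∀ i, (2:ℝ)^k * (N i : ℝ) ≤ x i ∧ x i < (2:ℝ)^k * ((N i : ℝ) + 1)}

/-- The index of the dyadic child of `cube d k N` determined by `η`. -/
def childIdx {d : ℕ} (N : Fin d → ℤ) (η : Fin d → Bool) : Fin d → ℤ :=
  fun i => 2 * N i + ((η i).toNat : ℤ)

/-- A generalized Haar function on the cube `cube d k N`, with coefficient `c η`
on the child indexed by `η`. -/
def gHaar {d : ℕ} (k : ℤ) (N : Fin d → ℤ) (c : (Fin d → Bool) → ℝ) :
    (Fin d → ℝ) → ℝ :=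
  fun x => ∑ η : Fin d → Bool,
    c η * (cube d (k-1) (childIdx N η)).indicator (fun _ => (1:ℝ)) x

/-- The `L^∞`-norm of the generalized Haar function with coefficients `c`. -/
def gHaarSup {d : ℕ} (c : (Fin d → Bool) → ℝ) : ℝ := ⨆ η, |c η|

/-- The index of the dyadic subcube of `cube d k N` of sidelength `2^{-m}` times
that of the cube, determined by `r`. -/
def subIdx {d : ℕ} (m : ℕ) (N : Fin d → ℤ) (r : Fin d → Fin (2^m)) : Fin d → ℤ :=
  fun i => 2^m * N i + ((r i : ℕ) : ℤ)

/-- A dyadic shift with parameters `(m, n)` on `ℝ^d`: for every dyadic cube `I`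
(indexed by `(k, N)`) and every pair of dyadic subcubes `I' ⊆ I` (of sidelength
`2^{-m} ℓ(I)`, indexed by `r`) and `I'' ⊆ I` (of sidelength `2^{-n} ℓ(I)`,
indexed by `s`), generalized Haar functions `h_{I'}` (with child coefficients
`A k N r s`) and `h_{I''}` (with child coefficients `B k N r s`) satisfying the
cancellation conditions and the normalization `‖h_{I'}‖_∞ ‖h_{I''}‖_∞ ≤ 1`. -/
structure DyadicShift (d m n : ℕ) where
  A : ℤ → (Fin d → ℤ) → (Fin d → Fin (2^m)) → (Fin d → Fin (2^n)) → (Fin d → Bool) → ℝ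
  B : ℤ → (Fin d → ℤ) → (Fin d → Fin (2^m)) → (Fin d → Fin (2^n)) → (Fin d → Bool) → ℝ
  cancelA : ∀ k N r s, ∑ η : Fin d → Bool, A k N r s η = 0
  cancelB : ∀ k N r s, ∑ η : Fin d → Bool, B k N r s η = 0
  norm_le : ∀ k N r s η η', |A k N r s η| * |B k N r s η'| ≤ 1

/-- A single term (corresponding to the dyadic cube `cube d k N`) of the dyadic
shift: `(1/|I|) Σ_{I',I''} ⟨f, h_{I'}⟩ h_{I''}(x)`. -/
def shiftTerm {d m n : ℕ} (S : DyadicShift d m n) (f : (Fin d → ℝ) → ℝ)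
    (k : ℤ) (N : Fin d → ℤ) (x : Fin d → ℝ) : ℝ :=
  ((2:ℝ)^(k * (d:ℤ)))⁻¹ * ∑ r : Fin d → Fin (2^m), ∑ s : Fin d → Fin (2^n),
    (∫ y, f y * gHaar (k - (m:ℤ)) (subIdx m N r) (S.A k N r s) y)
      * gHaar (k - (n:ℤ)) (subIdx n N s) (S.B k N r s) x

/-- The dyadic shift operator `𝕊`. -/
def shiftOp {d m n : ℕ} (S : DyadicShift d m n) (f : (Fin d → ℝ) → ℝ) :
    (Fin d → ℝ) → ℝ :=
  fun x => ∑' q : ℤ × (Fin d → ℤ), shiftTerm S f q.1 q.2 x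

/-- The union of the boundaries of all dyadic cubes in `ℝ^d`. -/
def dyadBoundary (d : ℕ) : Set (Fin d → ℝ) :=
  ⋃ k : ℤ, ⋃ N : Fin d → ℤ, frontier (cube d k N)

/-- An axis-parallel cube `∏_i [a i, a i + l)` in `ℝ^d`. -/
def Qcube (d : ℕ) (a : Fin d → ℝ) (l : ℝ) : Set (Fin d → ℝ) :=
  {x | ∀ i, a i ≤ x i ∧ x i < a i + l}

/-- The BMO norm on `ℝ^d`, over all axis-parallel cubes (values in `ℝ≥0∞`). -/
def bmoRd (d : ℕ) (b : (Fin d → ℝ) → ℝ) : ℝ≥0∞ :=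
  ⨆ a : Fin d → ℝ, ⨆ l : ℝ, ⨆ (_ : 0 < l), ENNReal.ofReal
    ((l^d)⁻¹ * ∫ x in Qcube d a l, |b x - (l^d)⁻¹ * ∫ y in Qcube d a l, b y|)

/-- `b ∈ CMO(ℝ^d)`: `b` can be approximated in BMO norm by `C_c^∞` functions. -/
def CMORd (d : ℕ) (b : (Fin d → ℝ) → ℝ) : Prop :=
  ∀ δ : ℝ, 0 < δ → ∃ g : (Fin d → ℝ) → ℝ, ContDiff ℝ (⊤ : ℕ∞) g ∧ HasCompactSupport g ∧
    bmoRd d (fun x => b x - g x) < ENNReal.ofReal δ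

/-- Relative compactness (total boundedness) of a set of functions in `L^p(ℝ^d)`.
In the complete space `L^p`, this is equivalent to relative compactness. -/
def RelCompLpD (d : ℕ) (p : ℝ) (S : Set ((Fin d → ℝ) → ℝ)) : Prop :=
  ∀ δ : ℝ, 0 < δ → ∃ F : Finset ((Fin d → ℝ) → ℝ), ∀ f ∈ S, ∃ g ∈ F,
    eLpNorm (fun x => f x - g x) (ENNReal.ofReal p) volume < ENNReal.ofReal δ

/-- The dyadic Hardy–Littlewood maximal function on `ℝ^d` (values in `ℝ≥0∞`). -/
def dyadMaxFn (d : ℕ) (g : (Fin d → ℝ) → ℝ) (x : Fin d → ℝ) : ℝ≥0∞ :=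
  ⨆ k : ℤ, ⨆ N : Fin d → ℤ, ⨆ (_ : x ∈ cube d k N), ENNReal.ofReal
    (((2:ℝ)^(k * (d:ℤ)))⁻¹ * ∫ y in cube d k N, |g y|)

/-- `M_s^d g = (M^d(|g|^s))^{1/s}`. -/
def MsD (d : ℕ) (s : ℝ) (g : (Fin d → ℝ) → ℝ) (x : Fin d → ℝ) : ℝ≥0∞ :=
  (dyadMaxFn d (fun y => |g y| ^ s) x) ^ (1/s)

/-- The Fefferman–Stein sharp maximal function on `ℝ^d` (values in `ℝ≥0∞`). -/
def sharpMax (d : ℕ) (g : (Fin d → ℝ) → ℝ) (x : Fin d → ℝ) : ℝ≥0∞ :=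
  ⨆ a : Fin d → ℝ, ⨆ l : ℝ, ⨆ (_ : 0 < l), ⨆ (_ : x ∈ Qcube d a l), ENNReal.ofReal
    ((l^d)⁻¹ * ∫ y in Qcube d a l, |g y - (l^d)⁻¹ * ∫ z in Qcube d a l, g z|)

end

section DyadicCubes

variable {d : ℕ}

theorem cube_eq_pi (k : ℤ) (N : Fin d → ℤ) :
    cube d k N = Set.pi univ fun i => Ico ((2:ℝ)^k * (N i : ℝ)) ((2:ℝ)^k * ((N i : ℝ) + 1)) := by
  ext x
  simp [cube]

theorem measurableSet_cube (k : ℤ) (N : Fin d → ℤ) : MeasurableSet (cube d k N) := by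
  rw [cube_eq_pi]
  exact MeasurableSet.univ_pi fun i => measurableSet_Ico

theorem volume_cube (k : ℤ) (N : Fin d → ℤ) :
    volume (cube d k N) = ENNReal.ofReal ((2:ℝ)^(k * (d:ℤ))) := by
  rw [cube_eq_pi, volume_pi_pi]
  simp only [Real.volume_Ico]
  rw [← ENNReal.ofReal_prod_of_nonneg (fun i _ => by ring_nf; positivity)]
  congr 1
  calc ∏ i, ((2:ℝ)^k * ((N i : ℝ) + 1) - (2:ℝ)^k * (N i : ℝ)) = ∏ _i : Fin d, (2:ℝ)^k :=
        Finset.prod_congr rfl fun i _ => by ring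
    _ = (2:ℝ)^(k * (d:ℤ)) := by simp [zpow_mul]

theorem volume_real_cube (k : ℤ) (N : Fin d → ℤ) :
    volume.real (cube d k N) = (2:ℝ)^(k * (d:ℤ)) := by
  rw [measureReal_def, volume_cube, ENNReal.toReal_ofReal (by positivity)]

theorem eq_of_mem_cube {k : ℤ} {N N' : Fin d → ℤ} {x : Fin d → ℝ}
    (h : x ∈ cube d k N) (h' : x ∈ cube d k N') : N = N' := by
  funext i
  have hk : (0:ℝ) < 2^k := by positivity
  have h₁ := lt_of_mul_lt_mul_left ((h i).1.trans_lt (h' i).2) hk.le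
  have h₂ := lt_of_mul_lt_mul_left ((h' i).1.trans_lt (h i).2) hk.le
  norm_cast at h₁ h₂
  omega

theorem childIdx_injective (N : Fin d → ℤ) : Function.Injective (childIdx N) := by
  intro η η' h
  funext i
  have := congrFun h i
  simp only [childIdx] at this
  revert this
  cases η i <;> cases η' i <;> simp

theorem subIdx_injective (m : ℕ) (N : Fin d → ℤ) : Function.Injective (subIdx m N) := by
  intro r r' h
  funext i
  have := congrFun h i
  simp only [subIdx] at this
  exact Fin.ext (by omega)

theorem cube_childIdx_subset (k : ℤ) (N : Fin d → ℤ) (η : Fin d → Bool) :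
    cube d (k-1) (childIdx N η) ⊆ cube d k N := by
  intro x hx i
  have hk : (0:ℝ) < 2^(k-1) := by positivity
  have h2 : (2:ℝ)^k = 2^(k-1) * 2 := by
    rw [← zpow_add_one₀ (two_ne_zero), sub_add_cancel]
  have := hx i
  simp only [childIdx] at this
  rw [h2]
  cases h : η i <;> simp [h] at this <;> constructor <;> nlinarith

theorem integrableOn_cube {f : (Fin d → ℝ) → ℝ} (hf : Continuous f) (k : ℤ) (N : Fin d → ℤ) :
    IntegrableOn f (cube d k N) :=
  (hf.continuousOn.integrableOn_compact (isCompact_Icc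
    (a := fun i => (2:ℝ)^k * (N i : ℝ)) (b := fun i => (2:ℝ)^k * ((N i : ℝ) + 1)))).mono_set
    fun _ hx => ⟨fun i => (hx i).1, fun i => (hx i).2.le⟩

theorem norm_sub_le_of_mem_cube {k : ℤ} {N : Fin d → ℤ} {x y : Fin d → ℝ}
    (hx : x ∈ cube d k N) (hy : y ∈ cube d k N) : ‖x - y‖ ≤ (2:ℝ)^k := by
  refine (pi_norm_le_iff_of_nonneg (by positivity)).2 fun i => ?_
  have h₁ := hx i
  have h₂ := hy i
  rw [Pi.sub_apply, Real.norm_eq_abs, abs_le]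
  constructor <;> linarith

theorem gHaar_eq_of_mem {k : ℤ} {N : Fin d → ℤ} (c : (Fin d → Bool) → ℝ) {η : Fin d → Bool}
    {x : Fin d → ℝ} (hx : x ∈ cube d (k-1) (childIdx N η)) : gHaar k N c x = c η := by
  rw [gHaar, Finset.sum_eq_single η]
  · simp [hx]
  · intro η' _ hne
    rw [indicator_of_notMem, mul_zero]
    exact fun h => hne (childIdx_injective N (eq_of_mem_cube h hx))
  · simp

theorem gHaar_eq_zero {k : ℤ} {N : Fin d → ℤ} (c : (Fin d → Bool) → ℝ)
    {x : Fin d → ℝ} (hx : ∀ η, x ∉ cube d (k-1) (childIdx N η)) : gHaar k N c x = 0 :=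
  Finset.sum_eq_zero fun η _ => by simp [hx η]

theorem abs_gHaar_mul_le {k : ℤ} {N : Fin d → ℤ} {c : (Fin d → Bool) → ℝ} {b : ℝ}
    (h : ∀ η, |c η| * b ≤ 1) (x : Fin d → ℝ) :
    |gHaar k N c x| * b ≤ (cube d k N).indicator (fun _ => 1) x := by
  by_cases hx : ∃ η, x ∈ cube d (k-1) (childIdx N η)
  · obtain ⟨η, hη⟩ := hx
    rw [gHaar_eq_of_mem c hη, indicator_of_mem (cube_childIdx_subset k N η hη)]
    exact h η
  · push Not at hx
    rw [gHaar_eq_zero c hx, abs_zero, zero_mul]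
    exact indicator_nonneg (fun _ _ => zero_le_one) x

theorem mul_gHaar_eq_sum (f : (Fin d → ℝ) → ℝ) (k : ℤ) (N : Fin d → ℤ)
    (c : (Fin d → Bool) → ℝ) :
    (fun y => f y * gHaar k N c y) =
      fun y => ∑ η, c η * (cube d (k-1) (childIdx N η)).indicator f y := by
  funext y
  rw [gHaar, Finset.mul_sum]
  refine Finset.sum_congr rfl fun η _ => ?_
  by_cases hy : y ∈ cube d (k-1) (childIdx N η) <;> simp [hy, mul_comm]

theorem integrable_mul_gHaar {f : (Fin d → ℝ) → ℝ} (hf : Continuous f) (k : ℤ)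
    (N : Fin d → ℤ) (c : (Fin d → Bool) → ℝ) : Integrable fun y => f y * gHaar k N c y := by
  rw [mul_gHaar_eq_sum]
  exact integrable_finsetSum _ fun η _ =>
    ((integrable_indicator_iff (measurableSet_cube _ _)).2 (integrableOn_cube hf _ _)).const_mul _

theorem integral_const_mul_gHaar (a : ℝ) (k : ℤ) (N : Fin d → ℤ) {c : (Fin d → Bool) → ℝ}
    (hc : ∑ η, c η = 0) : ∫ y, a * gHaar k N c y = 0 := by
  rw [mul_gHaar_eq_sum (fun _ => a), integral_finsetSum _ fun η _ =>
    ((integrable_indicator_iff (measurableSet_cube _ _)).2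
      (integrableOn_cube continuous_const _ _)).const_mul _]
  simp only [integral_const_mul, integral_indicator (measurableSet_cube _ _),
    setIntegral_const, volume_real_cube]
  rw [← Finset.sum_mul, hc, zero_mul]

/-- Cancellation of the Haar function bounds its pairing with `f` by the oscillation of `f`. -/
theorem abs_integral_mul_gHaar_mul_le {f : (Fin d → ℝ) → ℝ} (hf : Continuous f) {M : ℝ}
    {k : ℤ} {N : Fin d → ℤ} (hM : ∀ y ∈ cube d k N, ∀ z ∈ cube d k N, |f y - f z| ≤ M)
    {c : (Fin d → Bool) → ℝ} (hc : ∑ η, c η = 0) {b : ℝ} (hb : 0 ≤ b)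
    (h : ∀ η, |c η| * b ≤ 1) :
    |∫ y, f y * gHaar k N c y| * b ≤ M * (2:ℝ)^(k * (d:ℤ)) := by
  set z : Fin d → ℝ := fun i => (2:ℝ)^k * (N i : ℝ)
  have hk : (0:ℝ) < 2^k := by positivity
  have hz : z ∈ cube d k N := fun i => ⟨le_rfl, by simp only [z]; gcongr; linarith⟩
  have hsub : ∫ y, f y * gHaar k N c y = ∫ y, (f y - f z) * gHaar k N c y := by
    simp only [sub_mul]
    rw [integral_sub (integrable_mul_gHaar hf k N c)
      (integrable_mul_gHaar (f := fun _ => f z) continuous_const k N c),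
      integral_const_mul_gHaar (f z) k N hc, sub_zero]
  have hM0 : 0 ≤ M := (abs_nonneg _).trans (hM z hz z hz)
  have hbound := norm_integral_le_of_norm_le (μ := volume)
    (f := fun y => (f y - f z) * gHaar k N c y * b)
    (g := (cube d k N).indicator fun _ => M)
    ((integrable_indicator_iff (measurableSet_cube _ _)).2 (integrableOn_cube continuous_const _ _))
    (.of_forall fun y => by
      rw [Real.norm_eq_abs, abs_mul, abs_mul, abs_of_nonneg hb, mul_assoc]
      have hy := abs_gHaar_mul_le (N := N) (k := k) h y
      by_cases hyc : y ∈ cube d k N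
      · rw [indicator_of_mem hyc] at hy ⊢
        exact (mul_le_mul (hM y hyc z hz) hy (by positivity) hM0).trans_eq (mul_one M)
      · rw [indicator_of_notMem hyc] at hy ⊢
        exact mul_nonpos_of_nonneg_of_nonpos (abs_nonneg _) hy)
  rw [integral_mul_const, ← hsub, integral_indicator (measurableSet_cube _ _),
    setIntegral_const, volume_real_cube, Real.norm_eq_abs, abs_mul, abs_of_nonneg hb,
    smul_eq_mul, mul_comm _ M] at hbound
  exact hbound

/-- A single term of a dyadic shift is bounded by the oscillation of `f` on the cubes `I'`. -/
theorem abs_shiftTerm_le_of_oscillation {m n : ℕ} (S : DyadicShift d m n)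
    {f : (Fin d → ℝ) → ℝ} (hf : Continuous f) {M : ℝ} (hM0 : 0 ≤ M) (k : ℤ) (N : Fin d → ℤ)
    (hM : ∀ r, ∀ y ∈ cube d (k - (m:ℤ)) (subIdx m N r), ∀ z ∈ cube d (k - (m:ℤ)) (subIdx m N r),
      |f y - f z| ≤ M) (x : Fin d → ℝ) :
    |shiftTerm S f k N x| ≤ M := by
  set V : ℝ := (2:ℝ)^((k - (m:ℤ)) * (d:ℤ))
  have hV : 0 ≤ M * V := by positivity
  have hpair (r : Fin d → Fin (2^m)) (s : Fin d → Fin (2^n)) :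
      |(∫ y, f y * gHaar (k - (m:ℤ)) (subIdx m N r) (S.A k N r s) y)
        * gHaar (k - (n:ℤ)) (subIdx n N s) (S.B k N r s) x| ≤
      (cube d (k - (n:ℤ)) (subIdx n N s)).indicator (fun _ => M * V) x := by
    rw [abs_mul]
    by_cases hx : ∃ η, x ∈ cube d (k - (n:ℤ) - 1) (childIdx (subIdx n N s) η)
    · obtain ⟨η, hη⟩ := hx
      rw [gHaar_eq_of_mem _ hη, indicator_of_mem (cube_childIdx_subset _ _ η hη)]
      exact abs_integral_mul_gHaar_mul_le hf (hM r) (S.cancelA k N r s) (abs_nonneg _)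
        fun η' => S.norm_le k N r s η' η
    · push Not at hx
      rw [gHaar_eq_zero _ hx, abs_zero, mul_zero]
      exact indicator_nonneg (fun _ _ => hV) x
  have hs : ∑ s : Fin d → Fin (2^n),
      (cube d (k - (n:ℤ)) (subIdx n N s)).indicator (fun _ => M * V) x ≤ M * V := by
    by_cases hx : ∃ s, x ∈ cube d (k - (n:ℤ)) (subIdx n N s)
    · obtain ⟨s, hs⟩ := hx
      rw [Finset.sum_eq_single s]
      · simp [hs]
      · exact fun s' _ hne => indicator_of_notMem
          (fun h => hne (subIdx_injective n N (eq_of_mem_cube h hs))) _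
      · simp
    · push Not at hx
      rw [Finset.sum_eq_zero fun s _ => indicator_of_notMem (hx s) _]
      exact hV
  have hcard : (2^m : ℝ)^d * V = (2:ℝ)^(k * (d:ℤ)) := by
    simp only [V]
    rw [← zpow_natCast (2:ℝ) m, ← zpow_natCast ((2:ℝ)^(m:ℤ)) d, ← zpow_mul,
      ← zpow_add₀ two_ne_zero]
    congr 1
    ring
  have hpos : (0:ℝ) < (2:ℝ)^(k * (d:ℤ)) := by positivity
  rw [shiftTerm, abs_mul, abs_of_pos (inv_pos.2 hpos), inv_mul_le_iff₀ hpos]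
  calc _ ≤ ∑ _r : Fin d → Fin (2^m), M * V :=
        (Finset.abs_sum_le_sum_abs _ _).trans <| Finset.sum_le_sum fun r _ =>
          (Finset.abs_sum_le_sum_abs _ _).trans <|
            (Finset.sum_le_sum fun s _ => hpair r s).trans hs
    _ = (2:ℝ)^(k * (d:ℤ)) * M := by
        simp only [Finset.sum_const, Finset.card_univ, Fintype.card_pi, Fintype.card_fin,
          Finset.prod_const, nsmul_eq_mul, Nat.cast_pow, Nat.cast_ofNat]
        rw [← hcard]
        ring

end DyadicCubes

/-- Bound for a single term of the dyadic shift applied to a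
differentiable function with gradient bounded by `C`:
`|term_I(x)| ≤ 2^{-m} √d · C · ℓ(I)`. -/
theorem shift_single_term_bound (d m n : ℕ) (hd : 0 < d) (S : DyadicShift d m n)
    (f : (Fin d → ℝ) → ℝ) (hdiff : Differentiable ℝ f)
    (C : ℝ) (hC : ∀ x, ‖fderiv ℝ f x‖ ≤ C)
    (k : ℤ) (N : Fin d → ℤ) (x : Fin d → ℝ) :
    |shiftTerm S f k N x| ≤ (2:ℝ)^(-(m:ℤ)) * Real.sqrt d * C * (2:ℝ)^k := by
  have hC0 : 0 ≤ C := (norm_nonneg _).trans (hC 0)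
  have hM : |shiftTerm S f k N x| ≤ C * (2:ℝ)^(k - (m:ℤ)) := by
    refine abs_shiftTerm_le_of_oscillation S hdiff.continuous (by positivity) k N
      (fun r y hy z hz => ?_) x
    refine (convex_univ.norm_image_sub_le_of_norm_fderiv_le (𝕜 := ℝ)
      (fun w _ => hdiff w) (fun w _ => hC w) (mem_univ z) (mem_univ y)).trans ?_
    gcongr
    exact norm_sub_le_of_mem_cube hy hz
  have hsqrt : 1 ≤ Real.sqrt d := Real.one_le_sqrt.2 (by exact_mod_cast hd)
  calc |shiftTerm S f k N x| ≤ 1 * (C * (2:ℝ)^(k - (m:ℤ))) := by rwa [one_mul]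
    _ ≤ Real.sqrt d * (C * (2:ℝ)^(k - (m:ℤ))) := by gcongr
    _ = (2:ℝ)^(-(m:ℤ)) * Real.sqrt d * C * (2:ℝ)^k := by
        rw [sub_eq_add_neg, zpow_add₀ two_ne_zero]
        ring
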